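/- Let ω be a linear order on {0,…,n} and let J = in_ω(I(ℛ_L)) be the initial ideal of the vanishing ideal of the reciprocal linear space. Then the degree deg ℛ_L equals the number of bases of the broken-circuit matroid M^ω(L), and the minimal primes of J are exactly the ideals ⟨y_i : i ∈ B^c⟩, where B runs over the bases of M^ω(L) and B^c = {0,…,n} ∖ B. -/

import Mathlib

open scoped BigOperators
noncomputable section

namespace ScatteringPaper

open CategoryTheory AlgebraicTopology

/- ## Topological Euler characteristic via rational singular homology -/

/-- The singular chain complex of a topological space, with rational coefficients. -/
def singularChainComplex (X : Type) [TopologicalSpace X] : ChainComplex (ModuleCat ℚ) ℕ :=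
  (alternatingFaceMapComplex (ModuleCat ℚ)).obj
    (((SimplicialObject.whiskering _ _).obj (ModuleCat.free ℚ)).obj (TopCat.toSSet.obj (TopCat.of X)))

/-- The `q`-th (rational) Betti number of a topological space. -/
def betti (X : Type) [TopologicalSpace X] (q : ℕ) : ℕ :=
  Module.finrank ℚ ((singularChainComplex X).homology q)

/-- The topological Euler characteristic, as the alternating sum of Betti numbers. -/
def eulerChar (X : Type) [TopologicalSpace X] : ℤ :=
  ∑ᶠ q : ℕ, (-1 : ℤ) ^ q * (betti X q : ℤ)

variable {d : ℕ} {ι : Type} [Fintype ι] [DecidableEq ι]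

/- ## Hyperplane arrangements: `(ℓ_i(x))_i = (1, x_1, …, x_d) · L` -/

/-- Value of the affine-linear form encoded by column `i` of `L`. -/
def ell (K : Type) [Field K] (L : Matrix (Fin (d+1)) ι K) (x : Fin d → K) (i : ι) : K :=
  L 0 i + ∑ j : Fin d, x j * L j.succ i

/-- The complement `X = ℂ^d ∖ 𝒜` of the arrangement `𝒜 = V(∏ ℓ_i)`. -/
def complementX (L : Matrix (Fin (d+1)) ι ℂ) : Set (Fin d → ℂ) := {x | ∀ i, ell ℂ L x i ≠ 0}

/-- `x ∈ X` is a solution of the scattering equations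
`∂ℒ_u/∂x_k = ∑_i u_i a_{ki}/ℓ_i(x) = 0`, `k = 1, …, d`. -/
def IsSol (L : Matrix (Fin (d+1)) ι ℂ) (u : ι → ℂ) (x : Fin d → ℂ) : Prop :=
  x ∈ complementX L ∧ ∀ k : Fin d, ∑ i : ι, u i * L k.succ i / ell ℂ L x i = 0

/-- An arrangement is essential if some subset of its hyperplanes meets in a single point. -/
def IsEssential (L : Matrix (Fin (d+1)) ι ℂ) : Prop :=
  ∃ (S : Set ι) (x₀ : Fin d → ℂ), {x : Fin d → ℂ | ∀ i ∈ S, ell ℂ L x i = 0} = {x₀}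

/-- `P u` holds for all `u` outside a proper algebraic subset (i.e. for generic `u`). -/
def Generically {σ : Type} [Fintype σ] [DecidableEq σ] (P : (σ → ℂ) → Prop) : Prop :=
  ∃ g : MvPolynomial σ ℂ, g ≠ 0 ∧ ∀ u : σ → ℂ, MvPolynomial.eval u g ≠ 0 → P u

/- ## Matroid data of the columns of `L` -/

/-- Rank of the set `I` of columns of `L` (the matroid rank in `M(L)`). -/
def rkL (K : Type) [Field K] (L : Matrix (Fin (d+1)) ι K) (I : Set ι) : ℕ :=
  Module.finrank K (Submodule.span K ((fun i => fun r => L r i) '' I))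

/-- Rank of the set `I` of columns of `A^⊤` (`L` with its first row deleted). -/
def rkA (K : Type) [Field K] (L : Matrix (Fin (d+1)) ι K) (I : Set ι) : ℕ :=
  Module.finrank K (Submodule.span K ((fun i => fun k : Fin d => L k.succ i) '' I))

/-- `I` is a flat of the matroid `M(L)`. -/
def IsFlat (K : Type) [Field K] (L : Matrix (Fin (d+1)) ι K) (I : Set ι) : Prop :=
  ∀ i ∉ I, rkL K L I < rkL K L (insert i I)

/-- `C` is a circuit of `M(L)`: a minimal linearly dependent set of columns. -/
def IsCircuit (K : Type) [Field K] (L : Matrix (Fin (d+1)) ι K) (C : Finset ι) : Prop :=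
  (¬ LinearIndependent K (fun i : {a // a ∈ C} => fun r => L r i.1)) ∧
  ∀ D : Finset ι, D ⊂ C → LinearIndependent K (fun i : {a // a ∈ D} => fun r => L r i.1)

/-- `M(L)` is connected: there is no separation into two nonempty parts with additive rank. -/
def MatroidConnected (K : Type) [Field K] (L : Matrix (Fin (d+1)) ι K) : Prop :=
  ∀ S : Set ι, S.Nonempty → Sᶜ.Nonempty → rkL K L S + rkL K L Sᶜ ≠ rkL K L Set.univ

/- ## The reciprocal linear space -/

/-- Zariski closure of a subset of affine space `K^ι`. -/
def zarClosure (K : Type) [Field K] (S : Set (ι → K)) : Set (ι → K) :=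
  {v | ∀ f : MvPolynomial ι K, (∀ w ∈ S, MvPolynomial.eval w f = 0) → MvPolynomial.eval v f = 0}

/-- The affine cone over the image of `φ : x ↦ (ℓ_0(x)⁻¹ : ⋯ : ℓ_n(x)⁻¹)`. -/
def coneImage (L : Matrix (Fin (d+1)) ι ℂ) : Set (ι → ℂ) :=
  {v | ∃ (c : ℂ) (x : Fin d → ℂ), x ∈ complementX L ∧ v = fun i => c / ell ℂ L x i}

/-- The vanishing ideal of a subset of affine space. -/
def vanishingIdeal (K : Type) [Field K] (S : Set (ι → K)) : Ideal (MvPolynomial ι K) where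
  carrier := {f | ∀ v ∈ S, MvPolynomial.eval v f = 0}
  add_mem' := by
    intro a b ha hb v hv
    simp [map_add, ha v hv, hb v hv]
  zero_mem' := by intro v hv; simp
  smul_mem' := by
    intro c f hf v hv
    simp [smul_eq_mul, map_mul, hf v hv]

/-- Projective space `ℙ^n = ℙ(ℂ^ι)`. -/
abbrev Pn (ι : Type) [Fintype ι] := Projectivization ℂ (ι → ℂ)

/-- The reciprocal linear space `ℛ_L ⊂ ℙ^n`, the Zariski closure of `im φ`. -/
def RL (L : Matrix (Fin (d+1)) ι ℂ) : Set (Pn ι) :=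
  {p | p.rep ∈ zarClosure ℂ (coneImage L)}

/-- The linear space `𝕃_u = {y : A^⊤ diag(u) y = 0} ⊂ ℙ^n`. -/
def LuSet (L : Matrix (Fin (d+1)) ι ℂ) (u : ι → ℂ) : Set (Pn ι) :=
  {p | ∀ k : Fin d, ∑ i : ι, L k.succ i * u i * p.rep i = 0}

/-- The torus orbit `U_I = {y ∈ ℙ^n : y_i ≠ 0 ⇔ i ∈ I}`. -/
def Ustratum (I : Set ι) : Set (Pn ι) := {p : Pn ι | ∀ i : ι, p.rep i ≠ 0 ↔ i ∈ I}

/-- `p = φ(x)` for the map `φ : x ↦ (ℓ_0(x)⁻¹ : ⋯ : ℓ_n(x)⁻¹)`. -/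
def PhiRel (L : Matrix (Fin (d+1)) ι ℂ) (x : Fin d → ℂ) (p : Pn ι) : Prop :=
  ∃ hv : (fun i => (ell ℂ L x i)⁻¹) ≠ 0, p = Projectivization.mk ℂ (fun i => (ell ℂ L x i)⁻¹) hv

/-- The image of `φ` in `ℙ^n`. -/
def imPhi (L : Matrix (Fin (d+1)) ι ℂ) : Set (Pn ι) :=
  {p | ∃ x ∈ complementX L, PhiRel L x p}

/-- Complement of the subarrangement `𝒜_I`. -/
def subComplement (L : Matrix (Fin (d+1)) ι ℂ) (I : Set ι) : Set (Fin d → ℂ) :=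
  {x | ∀ i ∈ I, ell ℂ L x i ≠ 0}

/-- The affine cone over the image of the reciprocal map of the subarrangement indexed by `I`,
embedded in the coordinate subspace `{y_i = 0, i ∉ I}`. -/
def coneImageSub (L : Matrix (Fin (d+1)) ι ℂ) (I : Set ι) : Set (ι → ℂ) :=
  {v | ∃ (c : ℂ) (x : Fin d → ℂ), x ∈ subComplement L I ∧
      v = I.indicator (fun i => c / ell ℂ L x i)}

/-- The reciprocal linear space `ℛ_{L_I}` of the submatrix `L_I`, embedded in `ℙ^n`. -/
def RLsub (L : Matrix (Fin (d+1)) ι ℂ) (I : Set ι) : Set (Pn ι) :=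
  {p | p.rep ∈ zarClosure ℂ (coneImageSub L I)}

/-- The open stratum `ℛ_{L_I}^∘ = ℛ_{L_I} ∩ U_I`. -/
def RLsubOpen (L : Matrix (Fin (d+1)) ι ℂ) (I : Set ι) : Set (Pn ι) :=
  RLsub L I ∩ Ustratum I

/- ## The very affine variety `X_I = (ℂ^d ∖ 𝒜_I)/K_I` -/

/-- Quotient of `ℂ^d ∖ 𝒜_I` by translation by the left kernel `K_I` of `A_I^⊤`:
two points are identified iff `A_I^⊤` takes the same values on them. -/
def XIsetoid (L : Matrix (Fin (d+1)) ι ℂ) (I : Set ι) : Setoid ↥(subComplement L I) where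
  r x y := ∀ i ∈ I, ∑ k : Fin d, (x : Fin d → ℂ) k * L k.succ i
      = ∑ k : Fin d, (y : Fin d → ℂ) k * L k.succ i
  iseqv := ⟨fun _ _ _ => rfl, fun h i hi => (h i hi).symm, fun h1 h2 i hi => (h1 i hi).trans (h2 i hi)⟩

/-- The very affine variety `X_I = (ℂ^d ∖ 𝒜_I)/K_I`. -/
def XI (L : Matrix (Fin (d+1)) ι ℂ) (I : Set ι) : Type := Quotient (XIsetoid L I)

instance (L : Matrix (Fin (d+1)) ι ℂ) (I : Set ι) : TopologicalSpace (XI L I) :=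
  instTopologicalSpaceQuotient

/-- The complement of the arrangement, over a general field `K`. -/
def complementK (K : Type) [Field K] (L : Matrix (Fin (d+1)) ι K) : Set (Fin d → K) :=
  {x | ∀ i, ell K L x i ≠ 0}

/-- The affine cone over the image of the reciprocal map, over a general field `K`. -/
def coneImageK (K : Type) [Field K] (L : Matrix (Fin (d+1)) ι K) : Set (ι → K) :=
  {v | ∃ (c : K) (x : Fin d → K), x ∈ complementK K L ∧ v = fun i => c / ell K L x i}

/- ## Hilbert functions, degree, Hilbert regularity -/

/-- The Hilbert function of the graded algebra `K[y]/I`: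
`q ↦ dim_K (K[y]/I)_q`. -/
def hilb (K : Type) [Field K] (I : Ideal (MvPolynomial ι K)) (q : ℕ) : ℕ :=
  Module.finrank K ((MvPolynomial.homogeneousSubmodule ι K q).map
    (Ideal.Quotient.mkₐ K I).toLinearMap)

/-- `k` is the degree of the `d`-dimensional projective variety with homogeneous
coordinate ring `K[y]/I`: the Hilbert polynomial has degree `d` and leading
coefficient `k/d!`. -/
def IsProjDegree (K : Type) [Field K] (I : Ideal (MvPolynomial ι K)) (d k : ℕ) : Prop :=
  ∃ P : Polynomial ℚ, (∃ N : ℕ, ∀ q : ℕ, N ≤ q → Polynomial.eval (q : ℚ) P = hilb K I q) ∧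
    P.degree = (d : WithBot ℕ) ∧ P.leadingCoeff = (k : ℚ) / (Nat.factorial d : ℚ)

/-- The Hilbert function, extended by `0` to negative integers. -/
def HFZ (K : Type) [Field K] (I : Ideal (MvPolynomial ι K)) (q : ℤ) : ℕ :=
  if 0 ≤ q then hilb K I q.toNat else 0

/-- The Hilbert regularity: the smallest degree from which the Hilbert function
agrees with a (necessarily unique) polynomial. -/
def HReg (K : Type) [Field K] (I : Ideal (MvPolynomial ι K)) : ℤ :=
  sInf {i : ℤ | ∃ P : Polynomial ℚ, ∀ q : ℤ, i ≤ q → Polynomial.eval (q : ℚ) P = HFZ K I q}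

/-- The `ω`-weight of an exponent vector. -/
def wtdeg {n : ℕ} (ω : Fin (n+1) → ℕ) (a : Fin (n+1) →₀ ℕ) : ℕ := ∑ i : Fin (n+1), ω i * a i

/-- The initial form `in_ω(f)`: the sum of the terms of maximal `ω`-weight. -/
def initForm {n : ℕ} (ω : Fin (n+1) → ℕ) (f : MvPolynomial (Fin (n+1)) ℂ) :
    MvPolynomial (Fin (n+1)) ℂ :=
  ∑ a ∈ f.support.filter (fun a => wtdeg ω a = f.support.sup (wtdeg ω)),
    MvPolynomial.monomial a (MvPolynomial.coeff a f)

/-- The initial ideal `in_ω(I)`. -/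
def initialIdeal {n : ℕ} (ω : Fin (n+1) → ℕ) (I : Ideal (MvPolynomial (Fin (n+1)) ℂ)) :
    Ideal (MvPolynomial (Fin (n+1)) ℂ) :=
  Ideal.span {g | ∃ f ∈ I, f ≠ 0 ∧ g = initForm ω f}

/-- `B` is a broken circuit: a circuit of `M(L)` with its `ω`-minimal element removed. -/
def IsBrokenCircuit {d n : ℕ} (L : Matrix (Fin (d+1)) (Fin (n+1)) ℂ) (ω : Fin (n+1) → ℕ)
    (B : Finset (Fin (n+1))) : Prop :=
  ∃ (C : Finset (Fin (n+1))) (i : Fin (n+1)), IsCircuit ℂ L C ∧ i ∈ C ∧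
    (∀ j ∈ C, ω i ≤ ω j) ∧ B = C.erase i

/-- `S` is independent in the broken-circuit matroid `M^ω(L)`
(whose circuits are the inclusion-minimal broken circuits). -/
def MwIndep {d n : ℕ} (L : Matrix (Fin (d+1)) (Fin (n+1)) ℂ) (ω : Fin (n+1) → ℕ)
    (S : Finset (Fin (n+1))) : Prop :=
  ∀ B : Finset (Fin (n+1)), IsBrokenCircuit L ω B → ¬ B ⊆ S

/-- `B` is a basis of the broken-circuit matroid `M^ω(L)`. -/
def MwBasis {d n : ℕ} (L : Matrix (Fin (d+1)) (Fin (n+1)) ℂ) (ω : Fin (n+1) → ℕ)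
    (B : Finset (Fin (n+1))) : Prop :=
  MwIndep L ω B ∧ ∀ S : Finset (Fin (n+1)), MwIndep L ω S → B ⊆ S → S = B

/-! ### Helper material: abstract nbc sets -/

/-- Abstract no-broken-circuit condition for a family of vectors. -/
def NBC {σ W : Type} [AddCommGroup W] [Module ℂ W] (w : σ → ℕ) (v : σ → W) (E S : Finset σ) :
    Prop :=
  S ⊆ E ∧ ∀ T ⊆ S, ∀ e ∈ E, (∀ t ∈ T, w e < w t) →
    v e ∉ Submodule.span ℂ (v '' (T : Set σ))

theorem NBC.mono {σ W : Type} [AddCommGroup W] [Module ℂ W] {w : σ → ℕ} {v : σ → W}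
    {E S S' : Finset σ} (h : NBC w v E S) (hS : S' ⊆ S) : NBC w v E S' :=
  ⟨hS.trans h.1, fun T hT => h.2 T (hT.trans hS)⟩

theorem NBC.contract {σ V : Type} [DecidableEq σ] [AddCommGroup V] [Module ℂ V] {w : σ → ℕ}
    {l : σ → (V →ₗ[ℂ] ℂ)} {E S : Finset σ} {m : σ} (hm : ∀ x ∈ E, w x < w m) (hSE : S ⊆ E)
    (h : NBC w l (insert m E) (insert m S)) (u : V) (hu : l m u = 1) :
    NBC w (fun i => (l i).comp (LinearMap.ker (l m)).subtype) E S := by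
  refine ⟨hSE, fun T hT e he hlt hmem => ?_⟩
  refine h.2 (insert m T) (Finset.insert_subset_insert m hT) e (Finset.mem_insert_of_mem he) ?_ ?_
  · intro t ht
    rcases Finset.mem_insert.1 ht with rfl | ht
    · exact hm e he
    · exact hlt t ht
  · let R : (V →ₗ[ℂ] ℂ) →ₗ[ℂ] (LinearMap.ker (l m) →ₗ[ℂ] ℂ) :=
      LinearMap.lcomp ℂ ℂ (LinearMap.ker (l m)).subtype
    have h1 : ((fun i => (l i).comp (LinearMap.ker (l m)).subtype) '' (T : Set σ))
        = R '' (l '' (T : Set σ)) := by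
      rw [Set.image_image]; rfl
    rw [h1, Submodule.span_image] at hmem
    obtain ⟨g, hg, hge⟩ := hmem
    have h2 : l e = g + ((l e - g) u) • l m := by
      ext x
      have hx : x - l m x • u ∈ LinearMap.ker (l m) := by simp [hu]
      have h3 := LinearMap.congr_fun hge ⟨_, hx⟩
      simp [R] at h3
      simp
      linear_combination -h3
    rw [h2]
    refine Submodule.add_mem _ (Submodule.span_mono ?_ hg) (Submodule.smul_mem _ _
      (Submodule.subset_span ⟨m, by simp, rfl⟩))
    exact Set.image_mono (by simp)

theorem limit_zero {f : ℂ → ℂ} (hf : ContinuousAt f 0)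
    (h : ∀ᶠ t in nhdsWithin (0 : ℂ) {0}ᶜ, f t = 0) : f 0 = 0 := by
  have h1 : Filter.Tendsto f (nhdsWithin (0 : ℂ) {0}ᶜ) (nhds (f 0)) :=
    hf.tendsto.mono_left nhdsWithin_le_nhds
  have h2 : Filter.Tendsto f (nhdsWithin (0 : ℂ) {0}ᶜ) (nhds 0) :=
    tendsto_const_nhds.congr' (h.mono fun t ht => ht.symm)
  exact tendsto_nhds_unique h1 h2

theorem eventually_lin_ne {a b : ℂ} (h : a ≠ 0 ∨ b ≠ 0) :
    ∀ᶠ t in nhdsWithin (0 : ℂ) {0}ᶜ, a + t * b ≠ 0 := by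
  by_cases ha : a = 0
  · subst ha
    have hb : b ≠ 0 := by simpa using h
    filter_upwards [self_mem_nhdsWithin] with t ht
    simpa [hb] using ht
  · have hc : ContinuousAt (fun t : ℂ => a + t * b) 0 := by fun_prop
    exact (hc.eventually_ne (by simpa using ha)).filter_mono nhdsWithin_le_nhds

theorem nbc_indep {σ κ : Type} [DecidableEq σ] (w : σ → ℕ) (hw : Function.Injective w)
    (E : Finset σ) :
    ∀ (V : Type) [AddCommGroup V] [Module ℂ V] (l : σ → (V →ₗ[ℂ] ℂ)) (A : Finset κ)
      (a : κ → σ → ℕ) (c : κ → ℂ),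
      (∀ x ∈ A, NBC w l E (E.filter (fun i => a x i ≠ 0))) →
      (∀ x ∈ A, ∀ y ∈ A, (∀ i ∈ E, a x i = a y i) → x = y) →
      (∀ v, (∀ i ∈ E, l i v ≠ 0) → ∑ x ∈ A, c x * ∏ i ∈ E, ((l i v)⁻¹) ^ (a x i) = 0) →
      ∀ x ∈ A, c x = 0 := by
  classical
  induction E using Finset.induction_on_max_value w with
  | empty =>
    intro V _ _ l A a c hn hinj hv x hx
    have h := hv 0 (by simp)
    have hA : A = {x} := by
      ext y
      simp only [Finset.mem_singleton]
      exact ⟨fun hy => hinj y hy x hx (by simp), fun h => h ▸ hx⟩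
    simpa [hA] using h
  | insert m E hmE hmax ih =>
    have hlt : ∀ x ∈ E, w x < w m := fun x hx =>
      lt_of_le_of_ne (hmax x hx) (fun h => hmE (hw h ▸ hx))
    intro V _ _ l A0 a c hn0 hinj0 hv0
    by_contra! hcon
    obtain ⟨x1, hx1, hcx1⟩ := hcon
    set A := A0.filter (fun x => c x ≠ 0) with hA
    have hAsub : ∀ x ∈ A, x ∈ A0 := fun x hx => (Finset.mem_filter.1 hx).1
    have hn : ∀ x ∈ A, NBC w l (insert m E) ((insert m E).filter (fun i => a x i ≠ 0)) :=
      fun x hx => hn0 x (hAsub x hx)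
    have hv : ∀ v, (∀ i ∈ insert m E, l i v ≠ 0) →
        ∑ x ∈ A, c x * ∏ i ∈ insert m E, ((l i v)⁻¹) ^ (a x i) = 0 := by
      intro v h
      rw [← hv0 v h, hA, Finset.sum_filter]
      refine Finset.sum_congr rfl fun x _ => ?_
      split_ifs with h'
      · rfl
      · rw [not_not.1 h', zero_mul]
    have hAne : A.Nonempty := ⟨x1, by simp [hA, hx1, hcx1]⟩
    obtain ⟨x0, hx0, hk⟩ := Finset.exists_max_image A (fun x => a x m) hAne
    set k := a x0 m with hkdef
    have hcx0 : c x0 ≠ 0 := (Finset.mem_filter.1 hx0).2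
    have hlm : l m ≠ 0 := by
      intro h
      exact (hn x0 hx0).2 ∅ (by simp) m (by simp) (by simp) (by simp [h])
    obtain ⟨u, hu⟩ : ∃ u, l m u = 1 := by
      obtain ⟨u, hu⟩ : ∃ u, l m u ≠ 0 := by
        by_contra! h
        exact hlm (LinearMap.ext h)
      exact ⟨(l m u)⁻¹ • u, by simp [hu]⟩
    have key : ∀ v, (∀ i ∈ E, l i v ≠ 0) →
        ∑ x ∈ A, c x * (l m v ^ (k - a x m) * ∏ i ∈ E, ((l i v)⁻¹) ^ (a x i)) = 0 := by
      intro v hvE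
      let f : ℂ → ℂ := fun t => ∑ x ∈ A, c x * ((l m v + t * l m u) ^ (k - a x m) *
        ∏ i ∈ E, ((l i v + t * l i u)⁻¹) ^ (a x i))
      have hf0 : f 0 = 0 := by
        apply limit_zero
        · refine tendsto_finsetSum _ fun x _ => ?_
          refine ContinuousAt.mul (by fun_prop) (ContinuousAt.mul (by fun_prop) ?_)
          refine tendsto_finsetProd _ fun i hi => ?_
          refine ContinuousAt.pow (ContinuousAt.inv₀ (by fun_prop) ?_) _
          simpa using hvE i hi
        · have e1 : ∀ᶠ t in nhdsWithin (0 : ℂ) {0}ᶜ, ∀ i ∈ insert m E,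
              l i v + t * l i u ≠ 0 := by
            rw [Finset.eventually_all]
            intro i hi
            apply eventually_lin_ne
            rcases Finset.mem_insert.1 hi with rfl | hi
            · right; simp [hu]
            · left; exact hvE i hi
          filter_upwards [e1] with t ht
          have h1 := hv (v + t • u) (by simpa using ht)
          have h2 : f t = (l m v + t * l m u) ^ k * ∑ x ∈ A, c x *
              ∏ i ∈ insert m E, ((l i (v + t • u))⁻¹) ^ (a x i) := by
            rw [Finset.mul_sum]
            refine Finset.sum_congr rfl fun x hx => ?_
            rw [Finset.prod_insert hmE]
            have hne := ht m (by simp)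
            have hkx : k = (k - a x m) + a x m := (Nat.sub_add_cancel (hk x hx)).symm
            simp only [map_add, map_smul, smul_eq_mul]
            have : (l m v + t * l m u) ^ k * ((l m v + t * l m u)⁻¹) ^ (a x m)
                = (l m v + t * l m u) ^ (k - a x m) := by
              conv_lhs => rw [hkx, pow_add, inv_pow]
              rw [mul_assoc, mul_inv_cancel₀ (pow_ne_zero _ hne), mul_one]
            rw [← this]; ring
          rw [h2, h1, mul_zero]
      simpa [f] using hf0
    rcases Nat.eq_zero_or_pos k with hk0 | hkpos
    · have ham : ∀ x ∈ A, a x m = 0 := fun x hx => by have := hk x hx; omega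
      refine hcx0 (ih V l A a c ?_ ?_ ?_ x0 hx0)
      · intro x hx
        have h := hn x hx
        rw [Finset.filter_insert, if_neg (by simp [ham x hx])] at h
        exact ⟨Finset.filter_subset _ _, fun T hT e he => h.2 T hT e (Finset.mem_insert_of_mem he)⟩
      · intro x hx y hy hxy
        refine hinj0 x (hAsub x hx) y (hAsub y hy) fun i hi => ?_
        rcases Finset.mem_insert.1 hi with rfl | hi
        · rw [ham x hx, ham y hy]
        · exact hxy i hi
      · intro v hvE
        simpa [hk0] using key v hvE
    · refine hcx0 (ih (LinearMap.ker (l m)) (fun i => (l i).comp (LinearMap.ker (l m)).subtype)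
        (A.filter (fun x => a x m = k)) a c ?_ ?_ ?_ x0 (by simp [hx0, hkdef]))
      · intro x hx
        obtain ⟨hx, hxk⟩ := Finset.mem_filter.1 hx
        have h := hn x hx
        rw [Finset.filter_insert, if_pos (by omega)] at h
        exact h.contract hlt (Finset.filter_subset _ _) u hu
      · intro x hx y hy hxy
        obtain ⟨hx, hxk⟩ := Finset.mem_filter.1 hx
        obtain ⟨hy, hyk⟩ := Finset.mem_filter.1 hy
        refine hinj0 x (hAsub x hx) y (hAsub y hy) fun i hi => ?_
        rcases Finset.mem_insert.1 hi with rfl | hi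
        · rw [hxk, hyk]
        · exact hxy i hi
      · intro v hvE
        have h := key (v : V) hvE
        rw [Finset.sum_filter]
        refine Eq.trans (Finset.sum_congr rfl fun x hx => ?_) h
        have hv0 : l m (v : V) = 0 := v.2
        split_ifs with hxk
        · simp [hxk]
        · have : k - a x m ≠ 0 := by have := hk x hx; omega
          simp [hv0, this]

theorem NBC.linearIndepOn {σ W : Type} [DecidableEq σ] [AddCommGroup W] [Module ℂ W] {w : σ → ℕ}
    (hw : Function.Injective w) {v : σ → W} {E : Finset σ} (S : Finset σ) (h : NBC w v E S) :
    LinearIndepOn ℂ v (S : Set σ) := by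
  induction S using Finset.induction_on_min_value w with
  | empty => simp
  | insert e S he hmin ih =>
    rw [Finset.coe_insert, linearIndepOn_insert (by simpa using he)]
    refine ⟨ih (h.mono (Finset.subset_insert _ _)), h.2 S (Finset.subset_insert _ _) e
      (h.1 (Finset.mem_insert_self _ _)) fun t ht => ?_⟩
    exact lt_of_le_of_ne (hmin t ht) fun hh => he (hw hh ▸ ht)

theorem NBC.extend {σ W : Type} [Fintype σ] [DecidableEq σ] [AddCommGroup W] [Module ℂ W]
    {w : σ → ℕ} {v : σ → W} {S : Finset σ} (h : NBC w v Finset.univ S)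
    (hsp : ∃ e, v e ∉ Submodule.span ℂ (v '' (S : Set σ))) :
    ∃ e ∉ S, NBC w v Finset.univ (insert e S) := by
  classical
  obtain ⟨e, he, hmin⟩ := Finset.exists_min_image
    (Finset.univ.filter fun e => v e ∉ Submodule.span ℂ (v '' (S : Set σ))) w
    (by obtain ⟨e, he⟩ := hsp; exact ⟨e, by simpa using he⟩)
  have he' : v e ∉ Submodule.span ℂ (v '' (S : Set σ)) := by simpa using he
  refine ⟨e, fun hS => he' (Submodule.subset_span ⟨e, hS, rfl⟩), by simp, ?_⟩
  intro T hT f _ hlt hf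
  by_cases heT : e ∈ T
  · have hT' : T.erase e ⊆ S := by
      intro x hx
      have := hT (Finset.mem_of_mem_erase hx)
      exact (Finset.mem_insert.1 this).resolve_left (Finset.ne_of_mem_erase hx)
    have hfS : v f ∈ Submodule.span ℂ (v '' (S : Set σ)) := by
      by_contra hcon
      have := hmin f (by simpa using hcon)
      have := hlt e heT
      omega
    refine h.2 (T.erase e) hT' f (Finset.mem_univ _)
      (fun t ht => hlt t (Finset.mem_of_mem_erase ht)) ?_
    rw [← Finset.insert_erase heT, Finset.coe_insert, Set.image_insert_eq,
      Submodule.mem_span_insert] at hf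
    obtain ⟨c, z, hz, hfz⟩ := hf
    have hzS : z ∈ Submodule.span ℂ (v '' (S : Set σ)) :=
      Submodule.span_mono (Set.image_mono (by exact_mod_cast hT')) hz
    by_cases hc : c = 0
    · rw [hfz, hc]; simpa using hz
    · exfalso
      apply he'
      have : v e = c⁻¹ • (v f - z) := by
        rw [hfz]; simp [smul_smul, hc]
      rw [this]
      exact Submodule.smul_mem _ _ (Submodule.sub_mem _ hfS hzS)
  · refine h.2 T ?_ f (Finset.mem_univ _) hlt hf
    intro x hx
    exact (Finset.mem_insert.1 (hT hx)).resolve_left (fun h => heT (h ▸ hx))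

/-! ### The nbc condition for the columns of `L` -/

/-- The columns of `L`. -/
def colv {d n : ℕ} (L : Matrix (Fin (d+1)) (Fin (n+1)) ℂ) (i : Fin (n+1)) : Fin (d+1) → ℂ :=
  fun r => L r i

/-- The linear forms given by the columns of `L`. -/
def lform {d n : ℕ} (L : Matrix (Fin (d+1)) (Fin (n+1)) ℂ) (i : Fin (n+1)) :
    (Fin (d+1) → ℂ) →ₗ[ℂ] ℂ :=
  dotProductEquiv ℂ (Fin (d+1)) (colv L i)

/-- The nbc condition for columns of `L`. -/
def N {d n : ℕ} (L : Matrix (Fin (d+1)) (Fin (n+1)) ℂ) (ω : Fin (n+1) → ℕ)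
    (S : Finset (Fin (n+1))) : Prop := NBC ω (colv L) Finset.univ S

theorem N.forms {d n : ℕ} {L : Matrix (Fin (d+1)) (Fin (n+1)) ℂ} {ω : Fin (n+1) → ℕ}
    {S : Finset (Fin (n+1))} (h : N L ω S) : NBC ω (lform L) Finset.univ S := by
  refine ⟨h.1, fun T hT e he hlt hmem => h.2 T hT e he hlt ?_⟩
  have h1 : lform L '' (T : Set (Fin (n+1)))
      = (dotProductEquiv ℂ (Fin (d+1))).toLinearMap '' (colv L '' (T : Set (Fin (n+1)))) := by
    rw [Set.image_image]; rfl
  rw [h1, Submodule.span_image] at hmem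
  obtain ⟨g, hg, hge⟩ := hmem
  have : g = colv L e := (dotProductEquiv ℂ (Fin (d+1))).injective hge
  exact this ▸ hg

theorem mwIndep_iff {d n : ℕ} (L : Matrix (Fin (d+1)) (Fin (n+1)) ℂ) (ω : Fin (n+1) → ℕ)
    (hω : Function.Injective ω) (S : Finset (Fin (n+1))) : MwIndep L ω S ↔ N L ω S := by
  constructor
  · intro h
    refine ⟨Finset.subset_univ _, ?_⟩
    intro T hT e _ hlt hmem
    induction T using Finset.strongInduction with
    | H T ih =>
      by_cases hex : ∃ T' ⊂ T, colv L e ∈ Submodule.span ℂ (colv L '' (T' : Set (Fin (n+1))))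
      · obtain ⟨T', hT', hm⟩ := hex
        exact ih T' hT' (hT'.1.trans hT) (fun t ht => hlt t (hT'.1 ht)) hm
      · push Not at hex
        have heT : e ∉ T := fun he => lt_irrefl _ (hlt e he)
        have hTi : LinearIndepOn ℂ (colv L) (T : Set (Fin (n+1))) := by
          rw [linearIndepOn_iff_notMem_span]
          intro t ht hsp
          refine hex (T.erase t) (Finset.erase_ssubset ht) ?_
          have hle : Submodule.span ℂ (colv L '' (T : Set (Fin (n+1))))
              ≤ Submodule.span ℂ (colv L '' ((T.erase t : Finset _) : Set (Fin (n+1)))) := by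
            rw [Submodule.span_le]
            rintro _ ⟨s, hs, rfl⟩
            by_cases hst : s = t
            · subst hst
              rw [Finset.coe_erase]
              exact hsp
            · exact Submodule.subset_span ⟨s, by simpa [hst] using hs, rfl⟩
          exact hle hmem
        refine h T ⟨insert e T, e, ⟨?_, ?_⟩, by simp, ?_, by simp [heT]⟩ hT
        · intro hli
          have hli' : LinearIndepOn ℂ (colv L) ((insert e T : Finset _) : Set (Fin (n+1))) := hli
          rw [Finset.coe_insert, linearIndepOn_insert (by simpa using heT)] at hli'
          exact hli'.2 hmem
        · intro D hD
          change LinearIndepOn ℂ (colv L) (D : Set (Fin (n+1)))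
          by_cases heD : e ∈ D
          · have hsub : D.erase e ⊂ T := by
              refine Finset.ssubset_iff_subset_ne.2 ⟨?_, ?_⟩
              · intro x hx
                exact (Finset.mem_insert.1 (hD.1 (Finset.mem_of_mem_erase hx))).resolve_left
                  (Finset.ne_of_mem_erase hx)
              · intro hh
                apply hD.ne
                rw [← hh, Finset.insert_erase heD]
            rw [← Finset.insert_erase heD, Finset.coe_insert, linearIndepOn_insert (by simp)]
            exact ⟨hTi.mono (by exact_mod_cast hsub.1), hex _ hsub⟩
          · refine hTi.mono fun x hx => ?_
            exact (Finset.mem_insert.1 (hD.1 hx)).resolve_left (fun hh => heD (hh ▸ hx))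
        · intro j hj
          rcases Finset.mem_insert.1 hj with rfl | hj
          · exact le_rfl
          · exact (hlt j hj).le
  · rintro h B ⟨C, i, ⟨hdep, hmin⟩, hiC, hle, rfl⟩ hBS
    refine h.2 (C.erase i) hBS i (Finset.mem_univ _) ?_ ?_
    · intro t ht
      exact lt_of_le_of_ne (hle t (Finset.mem_of_mem_erase ht))
        fun hh => Finset.ne_of_mem_erase ht (hω hh).symm
    · by_contra hcon
      apply hdep
      change LinearIndepOn ℂ (colv L) (C : Set (Fin (n+1)))
      rw [← Finset.insert_erase hiC, Finset.coe_insert, linearIndepOn_insert (by simp)]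
      exact ⟨hmin _ (Finset.erase_ssubset hiC), hcon⟩

theorem N.card_le {d n : ℕ} {L : Matrix (Fin (d+1)) (Fin (n+1)) ℂ} {ω : Fin (n+1) → ℕ}
    (hω : Function.Injective ω) {S : Finset (Fin (n+1))} (h : N L ω S) : S.card ≤ d + 1 := by
  have h1 := NBC.linearIndepOn hω S h
  have h2 := LinearIndependent.fintype_card_le_finrank h1
  simpa using h2

theorem mwBasis_iff {d n : ℕ} (L : Matrix (Fin (d+1)) (Fin (n+1)) ℂ) (hrank : L.rank = d + 1)
    (ω : Fin (n+1) → ℕ) (hω : Function.Injective ω) (S : Finset (Fin (n+1))) :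
    MwBasis L ω S ↔ N L ω S ∧ S.card = d + 1 := by
  unfold MwBasis
  simp only [mwIndep_iff L ω hω]
  constructor
  · rintro ⟨h, hmax⟩
    refine ⟨h, le_antisymm (h.card_le hω) ?_⟩
    by_contra! hlt
    have hsp : ∃ e, colv L e ∉ Submodule.span ℂ (colv L '' (S : Set (Fin (n+1)))) := by
      by_contra! hall
      have h1 : Submodule.span ℂ (Set.range L.col)
          ≤ Submodule.span ℂ (colv L '' (S : Set (Fin (n+1)))) := by
        rw [Submodule.span_le]
        rintro _ ⟨e, rfl⟩
        exact hall e
      have h2 := Submodule.finrank_mono h1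
      rw [← Matrix.rank_eq_finrank_span_cols, hrank] at h2
      have h3 := finrank_span_finset_le_card (R := ℂ) (S.image (colv L))
      rw [Set.finrank, Finset.coe_image] at h3
      have h4 := Finset.card_image_le (s := S) (f := colv L)
      omega
    obtain ⟨e, he, hN⟩ := NBC.extend h hsp
    have := hmax _ hN (Finset.subset_insert _ _)
    exact he (this ▸ Finset.mem_insert_self e S)
  · rintro ⟨h, hc⟩
    refine ⟨h, fun S' hS' hsub => ?_⟩
    exact (Finset.eq_of_subset_of_card_le hsub (by rw [hc]; exact hS'.card_le hω)).symm

theorem lform_eq {d n : ℕ} (L : Matrix (Fin (d+1)) (Fin (n+1)) ℂ) (c : ℂ) (x : Fin d → ℂ)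
    (i : Fin (n+1)) : lform L i (c • Fin.cons 1 x) = c * ell ℂ L x i := by
  simp [lform, colv, ell, dotProduct, Fin.sum_univ_succ, mul_add, mul_comm]

/-- nbc-supported elements of the vanishing ideal are zero. -/
theorem eq_zero_of_nbc {d n : ℕ} (L : Matrix (Fin (d+1)) (Fin (n+1)) ℂ)
    (ω : Fin (n+1) → ℕ) (hω : Function.Injective ω) (f : MvPolynomial (Fin (n+1)) ℂ)
    (hf : f ∈ vanishingIdeal ℂ (coneImage L)) (hN : ∀ a ∈ f.support, N L ω a.support) :
    f = 0 := by
  have h0 : ∀ z : Fin (d+1) → ℂ, z 0 ≠ 0 → (∀ i, lform L i z ≠ 0) →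
      MvPolynomial.eval (fun i => (lform L i z)⁻¹) f = 0 := by
    intro z hz hzi
    have hzx : z = z 0 • Fin.cons 1 (fun j => (z 0)⁻¹ * z (Fin.succ j)) := by
      ext j
      refine Fin.cases ?_ (fun j => ?_) j
      · simp
      · simp [hz]
    have hl : ∀ i, lform L i z = z 0 * ell ℂ L (fun j => (z 0)⁻¹ * z (Fin.succ j)) i := by
      intro i
      conv_lhs => rw [hzx]
      exact lform_eq _ _ _ _
    apply hf
    refine ⟨(z 0)⁻¹, fun j => (z 0)⁻¹ * z (Fin.succ j), fun i => ?_, ?_⟩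
    · have := hzi i
      rw [hl] at this
      exact right_ne_zero_of_mul this
    · funext i
      rw [hl, mul_inv, div_eq_mul_inv]
  have h1 : ∀ z : Fin (d+1) → ℂ, (∀ i, lform L i z ≠ 0) →
      MvPolynomial.eval (fun i => (lform L i z)⁻¹) f = 0 := by
    intro z hzi
    let u : Fin (d+1) → ℂ := Pi.single 0 1
    let g : ℂ → ℂ := fun t => MvPolynomial.eval (fun i => (lform L i z + t * lform L i u)⁻¹) f
    have hg : g 0 = 0 := by
      apply limit_zero
      · have hc : ContinuousAt (fun (t : ℂ) (i : Fin (n+1)) =>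
            (lform L i z + t * lform L i u)⁻¹) 0 := by
          rw [continuousAt_pi]
          intro i
          exact ContinuousAt.inv₀ (by fun_prop) (by simpa using hzi i)
        exact ContinuousAt.comp (f := fun (t : ℂ) (i : Fin (n+1)) =>
            (lform L i z + t * lform L i u)⁻¹) (g := fun y => MvPolynomial.eval y f)
            (MvPolynomial.continuous_eval f).continuousAt hc
      · have e1 : ∀ᶠ t in nhdsWithin (0 : ℂ) {0}ᶜ, ∀ i, lform L i z + t * lform L i u ≠ 0 := by
          rw [Filter.eventually_all]
          exact fun i => eventually_lin_ne (Or.inl (hzi i))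
        have e2 : ∀ᶠ t in nhdsWithin (0 : ℂ) {0}ᶜ, z 0 + t * 1 ≠ 0 :=
          eventually_lin_ne (Or.inr one_ne_zero)
        filter_upwards [e1, e2] with t ht1 ht2
        have := h0 (z + t • u) (by simpa [u] using ht2) (by simpa using ht1)
        simpa [g] using this
    simpa [g] using hg
  by_contra hne
  obtain ⟨a, ha⟩ := MvPolynomial.support_nonempty.2 hne
  refine (MvPolynomial.mem_support_iff.1 ha)
    (nbc_indep ω hω Finset.univ _ (lform L) f.support (fun a i => a i) (fun a => f.coeff a)
      ?_ ?_ ?_ a ha)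
  · intro x hx
    have : (Finset.univ.filter fun i => x i ≠ 0) = x.support := by
      ext i; simp
    rw [this]
    exact (hN x hx).forms
  · intro x _ y _ h
    ext i
    exact h i (Finset.mem_univ i)
  · intro v hv
    have := h1 v (fun i => hv i (Finset.mem_univ i))
    rwa [MvPolynomial.eval_eq'] at this

/-! ### Straightening -/

open MvPolynomial in
theorem circuit_rel {d n : ℕ} (L : Matrix (Fin (d+1)) (Fin (n+1)) ℂ)
    (T : Finset (Fin (n+1))) (e : Fin (n+1))
    (h : colv L e ∈ Submodule.span ℂ (colv L '' (T : Set (Fin (n+1))))) :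
    ∃ μ : Fin (n+1) → ℂ, (∏ t ∈ T, (X t : MvPolynomial (Fin (n+1)) ℂ)) -
      ∑ t ∈ T, C (μ t) * (X e * ∏ s ∈ T.erase t, X s) ∈ vanishingIdeal ℂ (coneImage L) := by
  rw [Submodule.mem_span_image_finset_iff_exists_fun] at h
  obtain ⟨μ₀, hμ₀⟩ := h
  let μ : Fin (n+1) → ℂ := fun t => if ht : t ∈ T then μ₀ ⟨t, ht⟩ else 0
  have hμ : ∑ t ∈ T, μ t • colv L t = colv L e := by
    rw [← hμ₀, ← Finset.sum_coe_sort]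
    exact Finset.sum_congr rfl fun t _ => by simp [μ]
  refine ⟨μ, ?_⟩
  rintro _ ⟨c, x, hx, rfl⟩
  have hell : ell ℂ L x e = ∑ t ∈ T, μ t * ell ℂ L x t := by
    have h1 := fun i => lform_eq L 1 x i
    simp only [one_smul, one_mul] at h1
    rw [← h1]
    simp only [lform, ← hμ, map_sum, map_smul, LinearMap.sum_apply, LinearMap.smul_apply,
      smul_eq_mul, ← h1]
  simp only [map_sub, map_prod, map_sum, map_mul, eval_X, eval_C]
  have h2 : ∀ t ∈ T, μ t * (c / ell ℂ L x e * ∏ s ∈ T.erase t, c / ell ℂ L x s)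
      = (μ t * ell ℂ L x t) * ((ell ℂ L x e)⁻¹ * ∏ s ∈ T, c / ell ℂ L x s) := by
    intro t ht
    rw [← Finset.mul_prod_erase T _ ht]
    have := hx t
    have := hx e
    field_simp
  rw [Finset.sum_congr rfl h2, ← Finset.sum_mul, ← hell, ← mul_assoc, mul_inv_cancel₀ (hx e),
    one_mul, sub_self]

theorem wtdeg_add {n : ℕ} (ω : Fin (n+1) → ℕ) (a b : Fin (n+1) →₀ ℕ) :
    wtdeg ω (a + b) = wtdeg ω a + wtdeg ω b := by
  simp [wtdeg, mul_add, Finset.sum_add_distrib]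

theorem wtdeg_single {n : ℕ} (ω : Fin (n+1) → ℕ) (i : Fin (n+1)) :
    wtdeg ω (Finsupp.single i 1) = ω i := by
  simp [wtdeg, Finsupp.single_apply]

open MvPolynomial in
theorem straighten_step {d n : ℕ} (L : Matrix (Fin (d+1)) (Fin (n+1)) ℂ)
    (ω : Fin (n+1) → ℕ) (a : Fin (n+1) →₀ ℕ) (ha : ¬ N L ω a.support) :
    ∃ (T : Finset (Fin (n+1))) (μ : Fin (n+1) → ℂ) (b : Fin (n+1) → (Fin (n+1) →₀ ℕ)),
      (monomial a (1 : ℂ) - ∑ t ∈ T, C (μ t) * monomial (b t) 1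
        ∈ vanishingIdeal ℂ (coneImage L)) ∧
      ∀ t ∈ T, wtdeg ω (b t) < wtdeg ω a ∧ (b t).degree = a.degree := by
  have : ∃ T ⊆ a.support, ∃ e, (∀ t ∈ T, ω e < ω t) ∧
      colv L e ∈ Submodule.span ℂ (colv L '' (T : Set (Fin (n+1)))) := by
    by_contra! hcon
    exact ha ⟨Finset.subset_univ _, fun T hT e _ hlt => hcon T hT e hlt⟩
  obtain ⟨T, hT, e, hlt, hsp⟩ := this
  obtain ⟨μ, hμ⟩ := circuit_rel L T e hsp
  let one : Finset (Fin (n+1)) → (Fin (n+1) →₀ ℕ) := fun S => ∑ t ∈ S, Finsupp.single t 1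
  have hone : ∀ S, monomial (one S) (1 : ℂ) = ∏ t ∈ S, X t := by
    intro S
    simp only [one, X, monomial_sum_one]
  have hle : one T ≤ a := by
    intro i
    simp only [one, Finsupp.finsetSum_apply, Finsupp.single_apply, Finset.sum_ite_eq']
    split_ifs with hi
    · exact Nat.one_le_iff_ne_zero.2 (Finsupp.mem_support_iff.1 (hT hi))
    · exact Nat.zero_le _
  obtain ⟨r, hr⟩ := exists_add_of_le hle
  refine ⟨T, μ, fun t => r + Finsupp.single e 1 + one (T.erase t), ?_, ?_⟩
  · have h1 := Ideal.mul_mem_left _ (monomial r (1 : ℂ)) hμ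
    convert h1 using 1
    rw [mul_sub, ← hone T, monomial_mul, Finset.mul_sum, hr, add_comm r (one T), one_mul]
    refine congrArg₂ (fun x y => x - y) rfl (Finset.sum_congr rfl fun t _ => ?_)
    have : monomial (r + Finsupp.single e 1 + one (T.erase t)) (1 : ℂ)
        = monomial r 1 * X e * ∏ s ∈ T.erase t, X s := by
      rw [← hone, X, monomial_mul, monomial_mul]; simp
    rw [this]; ring
  · intro t ht
    have h2 : one T = Finsupp.single t 1 + one (T.erase t) :=
      (Finset.add_sum_erase T (fun t => (Finsupp.single t 1 : Fin (n+1) →₀ ℕ)) ht).symm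
    have := hlt t ht
    rw [hr, h2]
    constructor
    · simp only [wtdeg_add, wtdeg_single]
      omega
    · simp only [map_add, Finsupp.degree_single]
      omega

open MvPolynomial in
theorem straighten {d n : ℕ} (L : Matrix (Fin (d+1)) (Fin (n+1)) ℂ)
    (ω : Fin (n+1) → ℕ) (M : ℕ) : ∀ a : Fin (n+1) →₀ ℕ, wtdeg ω a = M →
    ∃ g : MvPolynomial (Fin (n+1)) ℂ, monomial a 1 - g ∈ vanishingIdeal ℂ (coneImage L) ∧
      (∀ b ∈ g.support, N L ω b.support ∧ b.degree = a.degree ∧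
        (b = a ∨ wtdeg ω b < wtdeg ω a)) ∧
      (N L ω a.support → g = monomial a 1) := by
  classical
  induction M using Nat.strong_induction_on with
  | _ M ih =>
    intro a haM
    by_cases ha : N L ω a.support
    · refine ⟨monomial a 1, by simp, ?_, fun _ => rfl⟩
      intro b hb
      have : b = a := by simpa using support_monomial_subset hb
      subst this
      exact ⟨ha, rfl, Or.inl rfl⟩
    · obtain ⟨T, μ, b, hI, hb⟩ := straighten_step L ω a ha
      have h1 : ∀ t, t ∈ T → ∃ g : MvPolynomial (Fin (n+1)) ℂ,
          monomial (b t) 1 - g ∈ vanishingIdeal ℂ (coneImage L) ∧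
          (∀ c ∈ g.support, N L ω c.support ∧ c.degree = (b t).degree ∧
            (c = b t ∨ wtdeg ω c < wtdeg ω (b t))) ∧
          (N L ω (b t).support → g = monomial (b t) 1) :=
        fun t ht => ih _ (haM ▸ (hb t ht).1) (b t) rfl
      choose! g hg1 hg2 _ using h1
      refine ⟨∑ t ∈ T, C (μ t) * g t, ?_, ?_, fun h => absurd h ha⟩
      · have h3 : ∑ t ∈ T, C (μ t) * (monomial (b t) 1 - g t)
            ∈ vanishingIdeal ℂ (coneImage L) :=
          Ideal.sum_mem _ fun t ht => Ideal.mul_mem_left _ _ (hg1 t ht)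
        have h4 := Ideal.add_mem _ hI h3
        convert h4 using 1
        simp only [mul_sub, Finset.sum_sub_distrib]
        ring
      · intro c hc
        obtain ⟨t, ht, hct⟩ := Finset.mem_biUnion.1 (support_sum hc)
        have hct' : c ∈ (g t).support := by
          rw [C_mul'] at hct
          exact support_smul hct
        obtain ⟨q1, q2, q3⟩ := hg2 t ht c hct'
        refine ⟨q1, q2.trans (hb t ht).2, Or.inr ?_⟩
        have := (hb t ht).1
        rcases q3 with rfl | q3
        · exact this
        · exact q3.trans this

/-- Normal form of a monomial. -/
def nf {d n : ℕ} (L : Matrix (Fin (d+1)) (Fin (n+1)) ℂ) (ω : Fin (n+1) → ℕ)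
    (a : Fin (n+1) →₀ ℕ) : MvPolynomial (Fin (n+1)) ℂ :=
  (straighten L ω _ a rfl).choose

theorem nf_spec {d n : ℕ} (L : Matrix (Fin (d+1)) (Fin (n+1)) ℂ) (ω : Fin (n+1) → ℕ)
    (a : Fin (n+1) →₀ ℕ) :
    MvPolynomial.monomial a 1 - nf L ω a ∈ vanishingIdeal ℂ (coneImage L) ∧
      (∀ b ∈ (nf L ω a).support, N L ω b.support ∧ b.degree = a.degree ∧
        (b = a ∨ wtdeg ω b < wtdeg ω a)) ∧
      (N L ω a.support → nf L ω a = MvPolynomial.monomial a 1) :=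
  (straighten L ω _ a rfl).choose_spec

open MvPolynomial in
theorem sub_nf_mem {d n : ℕ} (L : Matrix (Fin (d+1)) (Fin (n+1)) ℂ) (ω : Fin (n+1) → ℕ)
    (f : MvPolynomial (Fin (n+1)) ℂ) :
    f - ∑ a ∈ f.support, C (f.coeff a) * nf L ω a ∈ vanishingIdeal ℂ (coneImage L) := by
  have h : f - ∑ a ∈ f.support, C (f.coeff a) * nf L ω a
      = ∑ a ∈ f.support, C (f.coeff a) * (monomial a 1 - nf L ω a) := by
    simp only [mul_sub, Finset.sum_sub_distrib, C_mul_monomial, mul_one]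
    congr 1
    exact f.as_sum
  rw [h]
  exact Ideal.sum_mem _ fun a _ => Ideal.mul_mem_left _ _ (nf_spec L ω a).1

/-- The Stanley–Reisner ideal of the nbc complex. -/
def srIdeal {d n : ℕ} (L : Matrix (Fin (d+1)) (Fin (n+1)) ℂ) (ω : Fin (n+1) → ℕ) :
    Ideal (MvPolynomial (Fin (n+1)) ℂ) :=
  Ideal.span {g | ∃ a : Fin (n+1) →₀ ℕ, ¬ N L ω a.support ∧ g = MvPolynomial.monomial a 1}

open MvPolynomial in
theorem initialIdeal_eq {d n : ℕ} (L : Matrix (Fin (d+1)) (Fin (n+1)) ℂ)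
    (ω : Fin (n+1) → ℕ) (hω : Function.Injective ω) :
    initialIdeal ω (vanishingIdeal ℂ (coneImage L)) = srIdeal L ω := by
  classical
  apply le_antisymm
  · refine Ideal.span_le.2 ?_
    rintro _ ⟨f, hf, hf0, rfl⟩
    refine Ideal.sum_mem _ fun a ha => ?_
    obtain ⟨ha1, ha2⟩ := Finset.mem_filter.1 ha
    have hna : ¬ N L ω a.support := by
      intro hN
      set r := ∑ b ∈ f.support, C (f.coeff b) * nf L ω b with hr
      have hrI : r ∈ vanishingIdeal ℂ (coneImage L) := by
        have := Ideal.sub_mem _ hf (sub_nf_mem L ω f)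
        simpa using this
      have hr0 : r = 0 := by
        refine eq_zero_of_nbc L ω hω r hrI fun c hc => ?_
        obtain ⟨b, hb, hcb⟩ := Finset.mem_biUnion.1 (support_sum hc)
        rw [C_mul'] at hcb
        exact ((nf_spec L ω b).2.1 c (support_smul hcb)).1
      have hca : r.coeff a = f.coeff a := by
        rw [hr, coeff_sum, Finset.sum_eq_single a]
        · rw [(nf_spec L ω a).2.2 hN]; simp
        · intro b hb hba
          rw [coeff_C_mul]
          have : (nf L ω b).coeff a = 0 := by
            by_contra hne
            rcases ((nf_spec L ω b).2.1 a (mem_support_iff.2 hne)).2.2 with h | h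
            · exact hba h.symm
            · have := Finset.le_sup (f := wtdeg ω) hb
              omega
          rw [this, mul_zero]
        · exact fun h => absurd ha1 h
      rw [hr0, coeff_zero] at hca
      exact mem_support_iff.1 ha1 hca.symm
    have : monomial a (f.coeff a) = C (f.coeff a) * monomial a 1 := by simp [C_mul_monomial]
    rw [this]
    exact Ideal.mul_mem_left _ _ (Ideal.subset_span ⟨a, hna, rfl⟩)
  · refine Ideal.span_le.2 ?_
    rintro _ ⟨a, ha, rfl⟩
    obtain ⟨h1, h2, _⟩ := nf_spec L ω a
    set f := monomial a (1 : ℂ) - nf L ω a with hf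
    have hlt : ∀ b ∈ (nf L ω a).support, wtdeg ω b < wtdeg ω a := by
      intro b hb
      obtain ⟨q1, _, q3⟩ := h2 b hb
      rcases q3 with rfl | q3
      · exact absurd q1 ha
      · exact q3
    have hanf : (nf L ω a).coeff a = 0 := by
      by_contra hne
      exact lt_irrefl _ (hlt a (mem_support_iff.2 hne))
    have hfa : f.coeff a = 1 := by simp [hf, hanf]
    have hasup : a ∈ f.support := by rw [mem_support_iff, hfa]; exact one_ne_zero
    have hsup : ∀ b ∈ f.support, b = a ∨ wtdeg ω b < wtdeg ω a := by
      intro b hb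
      by_cases hba : b = a
      · exact Or.inl hba
      · right
        apply hlt
        rw [mem_support_iff] at hb ⊢
        intro h0
        apply hb
        rw [hf, coeff_sub, h0, coeff_monomial, if_neg (Ne.symm hba), sub_zero]
    have hmax : f.support.sup (wtdeg ω) = wtdeg ω a := by
      apply le_antisymm
      · refine Finset.sup_le fun b hb => ?_
        rcases hsup b hb with rfl | h
        · exact le_rfl
        · exact h.le
      · exact Finset.le_sup (f := wtdeg ω) hasup
    refine Ideal.subset_span ⟨f, h1, fun h => by simp [h] at hasup, ?_⟩
    have hfil : f.support.filter (fun b => wtdeg ω b = f.support.sup (wtdeg ω)) = {a} := by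
      ext b
      rw [Finset.mem_filter, Finset.mem_singleton, hmax]
      constructor
      · rintro ⟨hb, hw⟩
        rcases hsup b hb with h | h
        · exact h
        · omega
      · rintro rfl
        exact ⟨hasup, rfl⟩
    rw [initForm, hfil, Finset.sum_singleton, hfa]

/-! ### Minimal primes -/

/-- The coordinate primes. -/
def coordP {n : ℕ} (B : Finset (Fin (n+1))) : Ideal (MvPolynomial (Fin (n+1)) ℂ) :=
  Ideal.span ((fun i => (MvPolynomial.X i : MvPolynomial (Fin (n+1)) ℂ)) ''
            (↑B : Set (Fin (n+1)))ᶜ)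

open MvPolynomial in
theorem coordP_ker {n : ℕ} (B : Finset (Fin (n+1))) :
    coordP B = RingHom.ker (aeval (R := ℂ) (fun i => if i ∈ B then
      (X i : MvPolynomial (Fin (n+1)) ℂ) else 0)) := by
  apply le_antisymm
  · refine Ideal.span_le.2 ?_
    rintro _ ⟨i, hi, rfl⟩
    have : i ∉ B := by simpa using hi
    simp [RingHom.mem_ker, this]
  · intro p hp
    have h : (Ideal.Quotient.mkₐ ℂ (coordP B)).comp (aeval (R := ℂ) (fun i => if i ∈ B then
      (X i : MvPolynomial (Fin (n+1)) ℂ) else 0)) = Ideal.Quotient.mkₐ ℂ (coordP B) := by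
      ext i
      by_cases hi : i ∈ B
      · simp [hi]
      · have : (X i : MvPolynomial (Fin (n+1)) ℂ) ∈ coordP B :=
          Ideal.subset_span ⟨i, by simpa using hi, rfl⟩
        simp [hi, (Ideal.Quotient.eq_zero_iff_mem.2 this)]
    have h2 := AlgHom.congr_fun h p
    rw [AlgHom.comp_apply, (RingHom.mem_ker).1 hp, map_zero] at h2
    exact Ideal.Quotient.eq_zero_iff_mem.1 h2.symm

theorem coordP_prime {n : ℕ} (B : Finset (Fin (n+1))) : (coordP B).IsPrime := by
  rw [coordP_ker]
  exact RingHom.ker_isPrime _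

open MvPolynomial in
theorem X_mem_coordP {n : ℕ} (B : Finset (Fin (n+1))) (i : Fin (n+1)) :
    (X i : MvPolynomial (Fin (n+1)) ℂ) ∈ coordP B ↔ i ∉ B := by
  rw [coordP_ker, RingHom.mem_ker]
  by_cases hi : i ∈ B <;> simp [hi]

theorem coordP_le {n : ℕ} {B B' : Finset (Fin (n+1))} (h : B ⊆ B') : coordP B' ≤ coordP B := by
  refine Ideal.span_le.2 ?_
  rintro _ ⟨i, hi, rfl⟩
  exact (X_mem_coordP B i).2 fun hB => (by simpa using hi : i ∉ B') (h hB)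

open MvPolynomial in
theorem srIdeal_le_coordP {d n : ℕ} {L : Matrix (Fin (d+1)) (Fin (n+1)) ℂ} {ω : Fin (n+1) → ℕ}
    {B : Finset (Fin (n+1))} (h : N L ω B) : srIdeal L ω ≤ coordP B := by
  refine Ideal.span_le.2 ?_
  rintro _ ⟨a, ha, rfl⟩
  have : ∃ i ∈ a.support, i ∉ B := by
    by_contra! hcon
    exact ha (NBC.mono h hcon)
  obtain ⟨i, hi, hiB⟩ := this
  have hd : (X i : MvPolynomial (Fin (n+1)) ℂ) ∣ monomial a 1 := by
    rw [X_dvd_monomial]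
    exact Or.inr (Finsupp.mem_support_iff.1 hi)
  exact Ideal.mem_of_dvd _ hd ((X_mem_coordP B i).2 hiB)

open MvPolynomial in
theorem exists_coordP_le {d n : ℕ} {L : Matrix (Fin (d+1)) (Fin (n+1)) ℂ} {ω : Fin (n+1) → ℕ}
    (hω : Function.Injective ω)
    {P : Ideal (MvPolynomial (Fin (n+1)) ℂ)} (hP : P.IsPrime) (h : srIdeal L ω ≤ P) :
    ∃ B, MwBasis L ω B ∧ coordP B ≤ P := by
  classical
  let S : Finset (Fin (n+1)) := Finset.univ.filter fun i => (X i : MvPolynomial _ ℂ) ∉ P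
  have hS : N L ω S := by
    by_contra hN
    let a : Fin (n+1) →₀ ℕ := ∑ i ∈ S, Finsupp.single i 1
    have hsupp : a.support = S := by
      ext i
      simp [a, Finsupp.single_apply]
    have hm : monomial a (1 : ℂ) ∈ P := h (Ideal.subset_span ⟨a, by rwa [hsupp], rfl⟩)
    have h2 : monomial a (1 : ℂ) = ∏ i ∈ S, X i := by
      simp only [a, X, monomial_sum_one]
    rw [h2, hP.prod_mem_iff] at hm
    obtain ⟨i, hi, hiP⟩ := hm
    exact (Finset.mem_filter.1 hi).2 hiP
  obtain ⟨B, hSB, hB⟩ := Set.Finite.exists_le_maximal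
    (Set.toFinite {B : Finset (Fin (n+1)) | N L ω B}) hS
  refine ⟨B, ⟨(mwIndep_iff L ω hω B).2 hB.1, fun S' hS' hle =>
    le_antisymm (hB.2 ((mwIndep_iff L ω hω S').1 hS') hle) hle⟩, ?_⟩
  refine Ideal.span_le.2 ?_
  rintro _ ⟨i, hi, rfl⟩
  by_contra hcon
  exact hi (hSB (by simp only [S, Finset.mem_filter, Finset.mem_univ, true_and]; exact hcon))

theorem minimalPrimes_eq {d n : ℕ} (L : Matrix (Fin (d+1)) (Fin (n+1)) ℂ)
    (ω : Fin (n+1) → ℕ) (hω : Function.Injective ω) :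
    (initialIdeal ω (vanishingIdeal ℂ (coneImage L))).minimalPrimes
      = {P | ∃ B : Finset (Fin (n+1)), MwBasis L ω B ∧ P = coordP B} := by
  rw [initialIdeal_eq L ω hω]
  ext P
  constructor
  · rintro ⟨⟨hP, hle⟩, hmin⟩
    obtain ⟨B, hB, hBP⟩ := exists_coordP_le hω hP hle
    refine ⟨B, hB, le_antisymm (hmin ⟨coordP_prime B, ?_⟩ hBP) hBP⟩
    exact srIdeal_le_coordP ((mwIndep_iff L ω hω B).1 hB.1)
  · rintro ⟨B, hB, rfl⟩
    refine ⟨⟨coordP_prime B, srIdeal_le_coordP ((mwIndep_iff L ω hω B).1 hB.1)⟩, ?_⟩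
    rintro Q ⟨hQ, hle⟩ hQB
    obtain ⟨B', hB', hB'Q⟩ := exists_coordP_le hω hQ hle
    have hsub : B ⊆ B' := by
      intro i hi
      by_contra hcon
      exact (X_mem_coordP B i).1 (hQB (hB'Q ((X_mem_coordP B' i).2 hcon))) hi
    have := hB.2 B' hB'.1 hsub
    rw [← this]
    exact hB'Q

/-! ### Hilbert function and degree -/

open Classical in
/-- nbc exponents of degree `q`. -/
def nbcExp {d n : ℕ} (L : Matrix (Fin (d+1)) (Fin (n+1)) ℂ) (ω : Fin (n+1) → ℕ) (q : ℕ) :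
    Finset (Fin (n+1) →₀ ℕ) :=
  (Finset.finsuppAntidiag Finset.univ q).filter fun a => N L ω a.support

theorem mem_nbcExp {d n : ℕ} {L : Matrix (Fin (d+1)) (Fin (n+1)) ℂ} {ω : Fin (n+1) → ℕ} {q : ℕ}
    {a : Fin (n+1) →₀ ℕ} : a ∈ nbcExp L ω q ↔ a.degree = q ∧ N L ω a.support := by
  simp [nbcExp, Finsupp.degree_eq_sum]

open MvPolynomial in
theorem hilb_eq {d n : ℕ} (L : Matrix (Fin (d+1)) (Fin (n+1)) ℂ)
    (ω : Fin (n+1) → ℕ) (hω : Function.Injective ω) (q : ℕ) :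
    hilb ℂ (vanishingIdeal ℂ (coneImage L)) q = (nbcExp L ω q).card := by
  classical
  set I := vanishingIdeal ℂ (coneImage L) with hI
  let b : nbcExp L ω q → (MvPolynomial (Fin (n+1)) ℂ ⧸ I) := fun a =>
    Ideal.Quotient.mkₐ ℂ I (monomial a.1 1)
  have hli : LinearIndependent ℂ b := by
    rw [Fintype.linearIndependent_iff]
    intro c hc
    let f : MvPolynomial (Fin (n+1)) ℂ := ∑ a : nbcExp L ω q, c a • monomial a.1 1
    have hfI : f ∈ I := by
      rw [← Ideal.Quotient.eq_zero_iff_mem, ← Ideal.Quotient.mkₐ_eq_mk ℂ]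
      simp only [f, map_sum, map_smul]
      exact hc
    have hf0 : f = 0 := by
      refine eq_zero_of_nbc L ω hω f hfI fun x hx => ?_
      obtain ⟨a, _, hxa⟩ := Finset.mem_biUnion.1 (support_sum hx)
      have : x = a.1 := by simpa using support_monomial_subset (support_smul hxa)
      rw [this]
      exact (mem_nbcExp.1 a.2).2
    intro a
    have h1 : f.coeff a.1 = c a := by
      simp only [f, coeff_sum, coeff_smul, coeff_monomial, smul_eq_mul, mul_ite, mul_one, mul_zero]
      rw [Finset.sum_eq_single a]
      · simp
      · intro a' _ hne
        rw [if_neg fun h => hne (Subtype.ext h)]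
      · simp
    rw [← h1, hf0, coeff_zero]
  have hspan : (homogeneousSubmodule (Fin (n+1)) ℂ q).map (Ideal.Quotient.mkₐ ℂ I).toLinearMap
      = Submodule.span ℂ (Set.range b) := by
    apply le_antisymm
    · rintro _ ⟨f, hf, rfl⟩
      have hf' : f.IsHomogeneous q := hf
      have h1 := Ideal.Quotient.eq.2 (sub_nf_mem L ω f)
      change Ideal.Quotient.mk I f ∈ _
      rw [h1, map_sum]
      refine Submodule.sum_mem _ fun a ha => ?_
      have hdeg : a.degree = q := by
        have := hf' (mem_support_iff.1 ha)
        rwa [Finsupp.degree_eq_weight_one]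
      rw [C_mul', ← Ideal.Quotient.mkₐ_eq_mk ℂ, map_smul]
      refine Submodule.smul_mem _ _ ?_
      rw [(nf L ω a).as_sum, map_sum]
      refine Submodule.sum_mem _ fun x hx => ?_
      obtain ⟨q1, q2, _⟩ := (nf_spec L ω a).2.1 x hx
      have : monomial x ((nf L ω a).coeff x) = (nf L ω a).coeff x • monomial x (1 : ℂ) := by
        simp [smul_monomial]
      rw [this, map_smul]
      exact Submodule.smul_mem _ _
        (Submodule.subset_span ⟨⟨x, mem_nbcExp.2 ⟨q2.trans hdeg, q1⟩⟩, rfl⟩)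
    · rw [Submodule.span_le]
      rintro _ ⟨a, rfl⟩
      refine ⟨monomial a.1 1, ?_, rfl⟩
      exact isHomogeneous_monomial _ (mem_nbcExp.1 a.2).1
  rw [hilb, hspan, finrank_span_eq_card hli, Fintype.card_coe]

/-- Number of exponents with given support. -/
theorem card_support_eq {n : ℕ} (S : Finset (Fin (n+1))) (hS : S.Nonempty) (q : ℕ)
    (hq : S.card ≤ q) :
    ((Finset.finsuppAntidiag Finset.univ q).filter
      fun a : Fin (n+1) →₀ ℕ => a.support = S).card = (q - 1).choose (S.card - 1) := by
  classical
  have h1 : ((Finset.finsuppAntidiag Finset.univ q).filter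
      fun a : Fin (n+1) →₀ ℕ => a.support = S).card = (S.finsuppAntidiag (q - S.card)).card := by
    let u : Fin (n+1) →₀ ℕ := ∑ i ∈ S, Finsupp.single i 1
    have hu : ∀ i, u i = if i ∈ S then 1 else 0 := by
      intro i
      simp [u, Finsupp.finsetSum_apply, Finsupp.single_apply]
    have hus : S.sum u = S.card := by
      simp [hu]
    symm
    refine Finset.card_bij (fun a _ => a + u) ?_ ?_ ?_
    · intro a ha
      rw [Finset.mem_finsuppAntidiag] at ha
      have hsup : (a + u).support = S := by
        ext i
        simp only [Finsupp.mem_support_iff, Finsupp.add_apply, hu]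
        by_cases hi : i ∈ S
        · simp [hi]
        · have : i ∉ a.support := fun h => hi (ha.2 h)
          simpa [hi] using this
      rw [Finset.mem_filter, Finset.mem_finsuppAntidiag]
      refine ⟨⟨?_, Finset.subset_univ _⟩, hsup⟩
      rw [← Finset.sum_subset (Finset.subset_univ S)]
      · simp only [Finsupp.coe_add, Pi.add_apply, Finset.sum_add_distrib]
        rw [ha.1, hus]
        omega
      · intro i _ hi
        rwa [← hsup, Finsupp.notMem_support_iff] at hi
    · intro a _ b _ h
      exact add_right_cancel h
    · intro a ha
      rw [Finset.mem_filter, Finset.mem_finsuppAntidiag] at ha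
      obtain ⟨⟨h1, _⟩, h2⟩ := ha
      have hle : u ≤ a := by
        intro i
        rw [hu]
        split_ifs with hi
        · rw [← h2, Finsupp.mem_support_iff] at hi
          omega
        · exact Nat.zero_le _
      refine ⟨a - u, ?_, tsub_add_cancel_of_le hle⟩
      rw [Finset.mem_finsuppAntidiag]
      constructor
      · have h3 : S.sum a = q := by
          rw [← h1]
          refine Finset.sum_subset (Finset.subset_univ S) fun i _ hi => ?_
          rwa [← h2, Finsupp.notMem_support_iff] at hi
        have h4 : S.sum (a - u) + S.sum u = S.sum a := by
          rw [← Finset.sum_add_distrib]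
          refine Finset.sum_congr rfl fun i _ => ?_
          rw [← Finsupp.add_apply, tsub_add_cancel_of_le hle]
        omega
      · rw [← h2]
        intro i hi
        rw [Finsupp.mem_support_iff] at hi ⊢
        intro h0
        apply hi
        simp [h0]
  rw [h1, Finset.card_finsuppAntidiag_nat_eq_choose]
  have hpos := hS.card_pos
  rw [show S.card + (q - S.card) - 1 = q - 1 by omega,
    show S.card - 1 = (q - 1) - (q - S.card) by omega]
  rw [Nat.choose_symm (by omega)]

open Filter Topology in
theorem tendsto_choose_div (k e : ℕ) (hke : k ≤ e) :
    Tendsto (fun q : ℕ => ((q - 1).choose k : ℝ) / (q : ℝ) ^ e) atTop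
      (𝓝 (if k = e then ((Nat.factorial e : ℝ))⁻¹ else 0)) := by
  rw [← tendsto_add_atTop_iff_nat 1]
  simp only [Nat.add_sub_cancel]
  have h1 : Tendsto (fun q : ℕ => (q.choose k : ℝ) / ((q : ℝ) ^ k / k.factorial)) atTop (𝓝 1) := by
    refine (Asymptotics.isEquivalent_iff_tendsto_one ?_).1 (isEquivalent_choose k)
    filter_upwards [eventually_gt_atTop 0] with q hq
    have : (0 : ℝ) < q := by exact_mod_cast hq
    positivity
  have h2 : Tendsto (fun q : ℕ => ((q : ℝ) / (q + 1)) ^ k) atTop (𝓝 (1 ^ k)) :=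
    (tendsto_natCast_div_add_atTop (1 : ℝ)).pow k
  have h3 : Tendsto (fun q : ℕ => (((q : ℝ) + 1)⁻¹) ^ (e - k)) atTop
      (𝓝 (if k = e then 1 else 0)) := by
    have h4 : Tendsto (fun q : ℕ => ((q : ℝ) + 1)⁻¹) atTop (𝓝 0) := by
      simpa using tendsto_one_div_add_atTop_nhds_zero_nat (𝕜 := ℝ)
    have h5 := h4.pow (e - k)
    convert h5 using 2
    split_ifs with h
    · simp [h]
    · rw [zero_pow (by omega)]
  have h6 := ((h1.mul h2).mul h3).mul_const ((k.factorial : ℝ)⁻¹)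
  have h7 : (1 * 1 ^ k * (if k = e then 1 else 0) * (k.factorial : ℝ)⁻¹ : ℝ)
      = if k = e then ((Nat.factorial e : ℝ))⁻¹ else 0 := by
    split_ifs with h <;> simp [h]
  rw [h7] at h6
  refine h6.congr' ?_
  filter_upwards [eventually_gt_atTop 0] with q hq
  have hq' : (0 : ℝ) < q := by exact_mod_cast hq
  have hk : (k.factorial : ℝ) ≠ 0 := by exact_mod_cast k.factorial_ne_zero
  have h8 : ((q : ℝ) + 1) ^ e = ((q : ℝ) + 1) ^ k * ((q : ℝ) + 1) ^ (e - k) := by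
    rw [← pow_add]; congr 1; omega
  push_cast
  rw [h8, div_pow, inv_pow]
  field_simp

open Filter Topology in
theorem tendsto_hilb {d n : ℕ} (L : Matrix (Fin (d+1)) (Fin (n+1)) ℂ) (hrank : L.rank = d + 1)
    (ω : Fin (n+1) → ℕ) (hω : Function.Injective ω) :
    Tendsto (fun q : ℕ => (hilb ℂ (vanishingIdeal ℂ (coneImage L)) q : ℝ) / (q : ℝ) ^ d) atTop
      (𝓝 (({B : Finset (Fin (n+1)) | MwBasis L ω B}.ncard : ℝ) / (d.factorial : ℝ))) := by
  classical
  let F : Finset (Finset (Fin (n+1))) := Finset.univ.filter fun S => N L ω S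
  have hlim : ∀ S ∈ F, Tendsto (fun q : ℕ => (((Finset.finsuppAntidiag Finset.univ q).filter
      fun a : Fin (n+1) →₀ ℕ => a.support = S).card : ℝ) / (q : ℝ) ^ d) atTop
      (𝓝 (if S.card = d + 1 then ((Nat.factorial d : ℝ))⁻¹ else 0)) := by
    intro S hS
    have hN : N L ω S := by simpa [F] using hS
    have hc := hN.card_le hω
    rcases S.eq_empty_or_nonempty with rfl | hne
    · rw [if_neg (by simp)]
      refine tendsto_const_nhds.congr' ?_
      filter_upwards [eventually_gt_atTop 0] with q hq
      have : ((Finset.finsuppAntidiag Finset.univ q).filter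
          fun a : Fin (n+1) →₀ ℕ => a.support = ∅) = ∅ := by
        refine Finset.filter_eq_empty_iff.2 fun a ha h => ?_
        rw [Finsupp.support_eq_empty] at h
        subst h
        simp [Finset.mem_finsuppAntidiag] at ha
        omega
      rw [this]; simp
    · have h1 := tendsto_choose_div (S.card - 1) d (by omega)
      have hpos := hne.card_pos
      have h2 : (S.card - 1 = d) = (S.card = d + 1) := by
        apply propext; omega
      simp only [h2] at h1
      refine h1.congr' ?_
      filter_upwards [eventually_ge_atTop S.card] with q hq
      rw [card_support_eq S hne q hq]
  have hsum := tendsto_finsetSum F hlim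
  have h3 : ∑ S ∈ F, (if S.card = d + 1 then ((Nat.factorial d : ℝ))⁻¹ else 0)
      = ({B : Finset (Fin (n+1)) | MwBasis L ω B}.ncard : ℝ) / (d.factorial : ℝ) := by
    have h4 : {B : Finset (Fin (n+1)) | MwBasis L ω B}
        = ((F.filter fun S => S.card = d + 1 : Finset _) : Set (Finset (Fin (n+1)))) := by
      ext S
      simp [F, mwBasis_iff L hrank ω hω]
    rw [h4, Set.ncard_coe_finset, ← Finset.sum_filter, Finset.sum_const, nsmul_eq_mul,
      div_eq_mul_inv]
  rw [h3] at hsum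
  refine hsum.congr fun q => ?_
  rw [← Finset.sum_div, hilb_eq L ω hω q]
  congr 1
  rw [← Nat.cast_sum]
  congr 1
  rw [Finset.card_eq_sum_card_fiberwise (f := fun a : Fin (n+1) →₀ ℕ => a.support) (t := F)]
  · refine Finset.sum_congr rfl fun S hS => ?_
    congr 1
    ext a
    simp only [nbcExp, Finset.mem_filter]
    constructor
    · rintro ⟨h1, rfl⟩
      exact ⟨⟨h1, by simpa [F] using hS⟩, rfl⟩
    · rintro ⟨⟨h1, _⟩, h2⟩
      exact ⟨h1, h2⟩
  · intro a ha
    simpa [F] using (mem_nbcExp.1 ha).2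

open Filter Topology in
theorem degree_eq {d n : ℕ} (L : Matrix (Fin (d+1)) (Fin (n+1)) ℂ) (hrank : L.rank = d + 1)
    (ω : Fin (n+1) → ℕ) (hω : Function.Injective ω) (k : ℕ)
    (hk : IsProjDegree ℂ (vanishingIdeal ℂ (coneImage L)) d k) :
    k = {B : Finset (Fin (n+1)) | MwBasis L ω B}.ncard := by
  obtain ⟨P, ⟨M, hM⟩, hdeg, hlc⟩ := hk
  have h1 := tendsto_hilb L hrank ω hω
  let PR : Polynomial ℝ := P.map (algebraMap ℚ ℝ)
  have hdeg' : PR.degree = (Polynomial.X ^ d : Polynomial ℝ).degree := by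
    simp [PR, hdeg]
  have h2 := (Polynomial.div_tendsto_atTop_leadingCoeff_div_of_degree_eq PR _ hdeg').comp
    tendsto_natCast_atTop_atTop
  have h3 : PR.leadingCoeff / (Polynomial.X ^ d : Polynomial ℝ).leadingCoeff
      = (k : ℝ) / d.factorial := by
    simp [PR, hlc]
  rw [h3] at h2
  have h4 := tendsto_nhds_unique (h2.congr' ?_) h1
  · have hd : (d.factorial : ℝ) ≠ 0 := by exact_mod_cast d.factorial_ne_zero
    rw [div_left_inj' hd] at h4
    exact_mod_cast h4
  · filter_upwards [eventually_ge_atTop M] with q hq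
    have h5 := hM q hq
    have h6 : Polynomial.eval (q : ℝ) PR = (hilb ℂ (vanishingIdeal ℂ (coneImage L)) q : ℝ) := by
      have : (q : ℝ) = algebraMap ℚ ℝ (q : ℚ) := by simp
      rw [this, Polynomial.eval_map_algebraMap, Polynomial.aeval_algebraMap_apply,
        Polynomial.coe_aeval_eq_eval, h5]
      simp
    simp [h6]

/-- Proposition 4.2.  The reciprocal degree `deg ℛ_L` equals the number of
bases of `M^ω(L)`, and the minimal primes of `J = in_ω(I(ℛ_L))` are exactly the ideals
`⟨y_i : i ∈ Bᶜ⟩` for `B` a basis of `M^ω(L)`. -/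
theorem reciprocal_degree_and_minimal_primes_of_initial_ideal
    {d n : ℕ} (L : Matrix (Fin (d+1)) (Fin (n+1)) ℂ) (hrank : L.rank = d + 1)
    (ω : Fin (n+1) → ℕ) (hω : Function.Injective ω) :
    (∀ k : ℕ, IsProjDegree ℂ (vanishingIdeal ℂ (coneImage L)) d k →
      (k : ℕ) = {B : Finset (Fin (n+1)) | MwBasis L ω B}.ncard) ∧
    (initialIdeal ω (vanishingIdeal ℂ (coneImage L))).minimalPrimes
      = {P | ∃ B : Finset (Fin (n+1)), MwBasis L ω B ∧
          P = Ideal.span ((fun i => (MvPolynomial.X i : MvPolynomial (Fin (n+1)) ℂ)) ''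
            (↑B : Set (Fin (n+1)))ᶜ)} := by
  exact ⟨fun k hk => degree_eq L hrank ω hω k hk, minimalPrimes_eq L ω hω⟩

end ScatteringPaper
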